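/- arXiv:2509.15932 — 4 statements merged into one kernel-verified Lean document; each statement's English description precedes it below -/
import Mathlib

section
/- Let J, S, Y be random variables taking values in finite sets, with J uniformly distributed on {1,…,M}, M ≥ 2, and J independent of S; set U = u^{(J)}, and suppose Y is conditionally independent of J given (U,S). Then for every decoder π : 𝒴 × 𝒮 → 𝒜, the mixture risk satisfies R_mix(π) := E[ℓ(U, π(Y,S))] ≥ (ε + Δ) · max{ 1 − (I(U;Y|S) + log 2)/log M , 0 }. -/
open MeasureTheory Real

/-- Shannon entropy (natural log) of a random variable taking values in a finite set. -/
noncomputable def entropy {Ω α : Type*} [MeasurableSpace Ω] [Fintype α]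
    (μ : Measure Ω) (X : Ω → α) : ℝ :=
  ∑ a : α, Real.negMulLog (μ (X ⁻¹' {a})).toReal

/-- Conditional mutual information I(X;Y|Z) = H(X|Z) + H(Y|Z) - H(X,Y|Z). -/
noncomputable def condMutualInfo {Ω α β γ : Type*} [MeasurableSpace Ω]
    [Fintype α] [Fintype β] [Fintype γ]
    (μ : Measure Ω) (X : Ω → α) (Y : Ω → β) (Z : Ω → γ) : ℝ :=
  entropy μ (fun ω => (X ω, Z ω)) + entropy μ (fun ω => (Y ω, Z ω))
    - entropy μ (fun ω => (X ω, Y ω, Z ω)) - entropy μ Z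

/-- Entropy is invariant under relabelling the values by an injective map. -/
theorem entropy_comp_of_injective {Ω α β : Type*} [MeasurableSpace Ω] [Fintype α] [Fintype β]
    (μ : Measure Ω) (X : Ω → α) {f : α → β} (hf : Function.Injective f) :
    entropy μ (fun ω => f (X ω)) = entropy μ X := by
  classical
  unfold entropy
  rw [← Finset.sum_subset (Finset.subset_univ (Finset.univ.image f)),
    Finset.sum_image hf.injOn]
  · refine Finset.sum_congr rfl fun a _ => ?_
    congr 3
    ext ω
    simp [hf.eq_iff]
  · intro b _ hb
    have : (fun ω => f (X ω)) ⁻¹' {b} = ∅ := by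
      ext ω
      simp only [Finset.mem_image, Finset.mem_univ, true_and, not_exists] at hb
      simpa using hb (X ω)
    simp [this]

/-- Conditional mutual information is invariant under injective relabelling of its first
argument. -/
theorem condMutualInfo_comp_of_injective {Ω α α' β γ : Type*} [MeasurableSpace Ω]
    [Fintype α] [Fintype α'] [Fintype β] [Fintype γ]
    (μ : Measure Ω) (X : Ω → α) (Y : Ω → β) (Z : Ω → γ) {f : α → α'}
    (hf : Function.Injective f) :
    condMutualInfo μ (fun ω => f (X ω)) Y Z = condMutualInfo μ X Y Z := by
  have hXZ : entropy μ (fun ω => (f (X ω), Z ω)) = entropy μ fun ω => (X ω, Z ω) :=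
    entropy_comp_of_injective μ (fun ω => (X ω, Z ω)) (f := Prod.map f id)
      (hf.prodMap Function.injective_id)
  have hXYZ : entropy μ (fun ω => (f (X ω), Y ω, Z ω)) = entropy μ fun ω => (X ω, Y ω, Z ω) :=
    entropy_comp_of_injective μ (fun ω => (X ω, Y ω, Z ω)) (f := Prod.map f id)
      (hf.prodMap Function.injective_id)
  unfold condMutualInfo
  rw [hXZ, hXYZ]

/-- The pointwise form of Gibbs' inequality. -/
theorem negMulLog_add_mul_log_le {p r q : ℝ} (hp : 0 ≤ p) (hpr : p ≤ r) (hq : 0 < q) :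
    Real.negMulLog p + p * Real.log r + p * Real.log q ≤ r * q - p := by
  rcases hp.eq_or_lt with rfl | hp
  · simpa using mul_nonneg hpr hq.le
  have hr : 0 < r := hp.trans_le hpr
  have h := Real.log_le_sub_one_of_pos (div_pos (mul_pos hr hq) hp)
  rw [Real.log_div (mul_pos hr hq).ne' hp.ne', Real.log_mul hr.ne' hq.ne'] at h
  have h' := mul_le_mul_of_nonneg_left h hp.le
  have e : p * (r * q / p - 1) = r * q - p := by field_simp
  rw [e] at h'
  unfold Real.negMulLog
  linarith

/-- Fano's inequality for a nonnegative array `p` and a guess `g` of the row from the column. -/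
theorem sum_negMulLog_sub_le_fano {ι W : Type*} [Fintype ι] [DecidableEq ι] [Fintype W]
    (p : ι → W → ℝ) (hp : ∀ j w, 0 ≤ p j w) (g : W → ι) :
    ∑ w, ∑ j, Real.negMulLog (p j w) - ∑ w, Real.negMulLog (∑ j, p j w)
      ≤ Real.log 2 * ∑ w, ∑ j, p j w
        + Real.log (Fintype.card ι) * ∑ w, ∑ j, if g w = j then 0 else p j w := by
  rw [← Finset.sum_sub_distrib, Finset.mul_sum, Finset.mul_sum, ← Finset.sum_add_distrib]
  refine Finset.sum_le_sum fun w _ => ?_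
  have hM : (0 : ℝ) < Fintype.card ι := by
    exact_mod_cast Fintype.card_pos_iff.mpr ⟨g w⟩
  set n := (Fintype.card ι : ℝ) with hn
  set r := ∑ j, p j w with hr
  have hr0 : 0 ≤ r := Finset.sum_nonneg fun j _ => hp j w
  let q : ι → ℝ := fun j => if g w = j then 1 / 2 else 1 / (2 * n)
  have hq : ∀ j, 0 < q j := fun j => by
    simp only [q]; split_ifs <;> positivity
  have hqsum : ∑ j, q j ≤ 1 := by
    have : ∀ j, q j ≤ (if g w = j then 1 / 2 else 0) + 1 / (2 * n) := fun j => by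
      have : 0 < 1 / (2 * n) := by positivity
      simp only [q]; split_ifs <;> linarith
    refine (Finset.sum_le_sum fun j _ => this j).trans ?_
    rw [Finset.sum_add_distrib, Finset.sum_ite_eq, Finset.sum_const, Finset.card_univ,
      nsmul_eq_mul, ← hn]
    simp only [Finset.mem_univ, if_true]
    field_simp
    norm_num
  have key : ∀ j, Real.negMulLog (p j w) ≤ -(p j w * Real.log r) + (r * q j - p j w)
      + (Real.log 2 * p j w + Real.log n * if g w = j then 0 else p j w) := fun j => by
    have h := negMulLog_add_mul_log_le (hp j w)
      (Finset.single_le_sum (fun i _ => hp i w) (Finset.mem_univ j)) (hq j)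
    rw [← hr] at h
    have e : p j w * Real.log (q j)
        = -(Real.log 2 * p j w + Real.log n * if g w = j then 0 else p j w) := by
      simp only [q]
      split_ifs
      · simp [mul_comm]
      · rw [one_div, Real.log_inv, Real.log_mul two_ne_zero hM.ne']; ring
    linarith
  have hs := Finset.sum_le_sum fun j (_ : j ∈ Finset.univ) => key j
  simp only [Finset.sum_add_distrib, Finset.sum_sub_distrib, Finset.sum_neg_distrib,
    ← Finset.sum_mul, ← Finset.mul_sum, ← hr] at hs
  have : r * ∑ j, q j ≤ r := mul_le_of_le_one_right hr0 hqsum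
  rw [show Real.negMulLog r = -(r * Real.log r) by simp [Real.negMulLog]]
  linarith

/-- Fano's inequality bounding `H(J, W) - H(W)` by the error probability of any estimator. -/
theorem entropy_sub_le_fano {Ω ι W : Type*} [MeasurableSpace Ω]
    [Fintype ι] [MeasurableSpace ι] [MeasurableSingletonClass ι]
    [Fintype W] [MeasurableSpace W] [MeasurableSingletonClass W]
    (μ : Measure Ω) [IsProbabilityMeasure μ] {J : Ω → ι} {X : Ω → W}
    (hJ : Measurable J) (hX : Measurable X) (g : W → ι) :
    entropy μ (fun ω => (J ω, X ω)) - entropy μ X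
      ≤ Real.log 2 + Real.log (Fintype.card ι) * μ.real {ω | g (X ω) ≠ J ω} := by
  classical
  set Z : Ω → ι × W := fun ω => (J ω, X ω) with hZ
  have hZm : Measurable Z := hJ.prodMk hX
  have hpre : ∀ T : Finset (ι × W), ∑ z ∈ T, μ.real (Z ⁻¹' {z}) = μ.real (Z ⁻¹' T) := fun T =>
    sum_measureReal_preimage_singleton T fun z _ => hZm (measurableSet_singleton z)
  have hmarg : ∀ w, ∑ j, μ.real (Z ⁻¹' {(j, w)}) = μ.real (X ⁻¹' {w}) := fun w => by
    have h := hpre (Finset.univ ×ˢ {w})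
    rw [Finset.sum_product] at h
    simp only [Finset.sum_singleton] at h
    rw [h]
    congr 1
    ext ω
    simp [hZ, eq_comm]
  have htot : ∑ w, ∑ j, μ.real (Z ⁻¹' {(j, w)}) = 1 := by
    rw [← Fintype.sum_prod_type_right (f := fun z => μ.real (Z ⁻¹' {z})), hpre]
    simp
  have herr : (∑ w, ∑ j, if g w = j then 0 else μ.real (Z ⁻¹' {(j, w)}))
      = μ.real {ω | g (X ω) ≠ J ω} := by
    rw [← Fintype.sum_prod_type_right
      (f := fun z : ι × W => if g z.2 = z.1 then 0 else μ.real (Z ⁻¹' {z}))]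
    have h := hpre (Finset.univ.filter fun z => g z.2 ≠ z.1)
    rw [Finset.sum_filter] at h
    simp only [ne_eq, ite_not] at h
    rw [h]
    congr 1
    ext ω
    simp [hZ]
  have h := sum_negMulLog_sub_le_fano (fun j w => μ.real (Z ⁻¹' {(j, w)}))
    (fun _ _ => measureReal_nonneg) g
  rw [htot, herr, mul_one] at h
  simp only [hmarg] at h
  rw [← Fintype.sum_prod_type_right (f := fun z => Real.negMulLog (μ.real (Z ⁻¹' {z})))] at h
  exact h

/-- If `J` is uniform and independent of `S`, then `H(J, S) = log |ι| + H(S)`. -/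
theorem entropy_prodMk_of_uniform {Ω ι 𝒮 : Type*} [MeasurableSpace Ω] [Fintype ι] [Nonempty ι]
    [Fintype 𝒮] [MeasurableSpace 𝒮] [MeasurableSingletonClass 𝒮]
    (μ : Measure Ω) [IsProbabilityMeasure μ] (J : Ω → ι) {S : Ω → 𝒮} (hS : Measurable S)
    (h : ∀ j s, μ {ω | J ω = j ∧ S ω = s} = 1 / (Fintype.card ι : ENNReal) * μ (S ⁻¹' {s})) :
    entropy μ (fun ω => (J ω, S ω)) = Real.log (Fintype.card ι) + entropy μ S := by
  have hn : (Fintype.card ι : ℝ) ≠ 0 := by exact_mod_cast Fintype.card_ne_zero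
  have hsum : ∑ s, (μ (S ⁻¹' {s})).toReal = 1 := by
    have := sum_measureReal_preimage_singleton (μ := μ) Finset.univ
      fun s (_ : s ∈ Finset.univ) => hS (measurableSet_singleton s)
    simpa [measureReal_def] using this
  unfold entropy
  have hpt : ∀ (j : ι) (s : 𝒮), (μ ((fun ω => (J ω, S ω)) ⁻¹' {(j, s)})).toReal
      = (Fintype.card ι : ℝ)⁻¹ * (μ (S ⁻¹' {s})).toReal := fun j s => by
    have e : (fun ω => (J ω, S ω)) ⁻¹' {(j, s)} = {ω | J ω = j ∧ S ω = s} := by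
      ext ω; simp
    rw [e, h]
    simp
  rw [Fintype.sum_prod_type]
  simp only [hpt, Real.negMulLog_mul, Finset.sum_add_distrib, ← Finset.sum_mul, ← Finset.mul_sum,
    hsum, Finset.sum_const, Finset.card_univ, nsmul_eq_mul, one_mul]
  simp only [Real.negMulLog, Real.log_inv]
  field_simp

/-- A nonnegative function that is at least `c` on `E` has integral at least `c * μ E`. -/
theorem mul_measureReal_le_integral {Ω : Type*} [MeasurableSpace Ω] {μ : Measure Ω}
    [IsFiniteMeasure μ] {f : Ω → ℝ} (hf : Integrable f μ) (hf0 : ∀ ω, 0 ≤ f ω) {E : Set Ω}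
    (hE : MeasurableSet E) {c : ℝ} (hc : ∀ ω ∈ E, c ≤ f ω) :
    c * μ.real E ≤ ∫ ω, f ω ∂μ := by
  calc c * μ.real E = ∫ ω, E.indicator (fun _ => c) ω ∂μ := by
        rw [integral_indicator_const _ hE, smul_eq_mul, mul_comm]
    _ ≤ ∫ ω, f ω ∂μ :=
        integral_mono ((integrable_const _).indicator hE) hf fun ω =>
          Set.indicator_le' (fun ω hω => hc ω hω) (fun ω _ => hf0 ω) ω

/-- Theorem 4.3 (Fano–Packing Lower Bound): for a Δ-separable codebook with loss–index link,
`J` uniform on `{1,…,M}` (`M ≥ 2`) independent of `S`, `U = u^{(J)}`, and `Y` conditionally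
independent of `J` given `(U,S)`, every decoder `π` satisfies
`R_mix(π) = E[ℓ(U, π(Y,S))] ≥ (ε+Δ)·max{1 − (I(U;Y|S) + log 2)/log M, 0}`. -/
theorem fano_packing_lower_bound
    {Ω 𝒰 𝒜 𝒴 𝒮 : Type*} [MeasurableSpace Ω]
    [Fintype 𝒰] [MeasurableSpace 𝒰] [MeasurableSingletonClass 𝒰]
    [MeasurableSpace 𝒜]
    [Fintype 𝒴] [MeasurableSpace 𝒴] [MeasurableSingletonClass 𝒴]
    [Fintype 𝒮] [MeasurableSpace 𝒮] [MeasurableSingletonClass 𝒮]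
    (μ : Measure Ω) [IsProbabilityMeasure μ]
    (M : ℕ) (hM : 2 ≤ M)
    (J : Ω → Fin M) (Y : Ω → 𝒴) (S : Ω → 𝒮)
    (hJ : Measurable J) (hY : Measurable Y) (hS : Measurable S)
    (hunif : ∀ j : Fin M, μ (J ⁻¹' {j}) = 1 / M)
    (hindep : ∀ (j : Fin M) (s : 𝒮),
      μ {ω | J ω = j ∧ S ω = s} = μ (J ⁻¹' {j}) * μ (S ⁻¹' {s}))
    (u : Fin M → 𝒰) (a : Fin M → 𝒜)
    (hcondindep : ∀ (j : Fin M) (y : 𝒴) (v : 𝒰) (s : 𝒮),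
      μ {ω | J ω = j ∧ Y ω = y ∧ u (J ω) = v ∧ S ω = s} * μ {ω | u (J ω) = v ∧ S ω = s}
        = μ {ω | J ω = j ∧ u (J ω) = v ∧ S ω = s}
          * μ {ω | Y ω = y ∧ u (J ω) = v ∧ S ω = s})
    (ℓ : 𝒰 → 𝒜 → ℝ) (hℓmeas : Measurable (Function.uncurry ℓ))
    (hℓ01 : ∀ x b, ℓ x b ∈ Set.Icc (0 : ℝ) 1)
    (ε Δ : ℝ) (hε : 0 ≤ ε) (hΔ : 0 < Δ) (hεΔ : ε + Δ ≤ 1)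
    (hgood : ∀ i, ℓ (u i) (a i) ≤ ε)
    (φ : 𝒜 → 𝒮 → Fin M) (hφ : Measurable (Function.uncurry φ))
    (hlink : ∀ (i : Fin M) (s : 𝒮) (b : 𝒜), φ b s ≠ i → ε + Δ ≤ ℓ (u i) b)
    (dec : 𝒴 → 𝒮 → 𝒜) (hdec : Measurable (Function.uncurry dec)) :
    (ε + Δ) * max (1 - (condMutualInfo μ (fun ω => u (J ω)) Y S + Real.log 2) / Real.log M) 0
      ≤ ∫ ω, ℓ (u (J ω)) (dec (Y ω) (S ω)) ∂μ := by
  classical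
  obtain ⟨ω₀⟩ : Nonempty Ω := nonempty_of_isProbabilityMeasure μ
  have : Nonempty (Fin M) := ⟨J ω₀⟩
  have hdecode : ∀ i b, ℓ (u i) b ≤ ε → φ b (S ω₀) = i := fun i b hb => by
    by_contra hne
    linarith [hlink i (S ω₀) b hne]
  have hu : Function.Injective u := fun i j hij =>
    (hdecode i (a i) (hgood i)).symm.trans (hdecode j (a i) (hij ▸ hgood i))
  have hlogM : 0 < Real.log M := Real.log_pos (by exact_mod_cast hM)
  set E : Set Ω := {ω | φ (dec (Y ω) (S ω)) (S ω) ≠ J ω}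
  have hmi : condMutualInfo μ (fun ω => u (J ω)) Y S
      = Real.log M + entropy μ (fun ω => (Y ω, S ω)) - entropy μ (fun ω => (J ω, Y ω, S ω)) := by
    rw [condMutualInfo_comp_of_injective μ J Y S hu, condMutualInfo,
      entropy_prodMk_of_uniform μ J hS fun j s => by rw [hindep, hunif, Fintype.card_fin],
      Fintype.card_fin]
    ring
  have hfano := entropy_sub_le_fano μ hJ (hY.prodMk hS) fun w => φ (dec w.1 w.2) w.2
  rw [Fintype.card_fin] at hfano
  have hmax : max (1 - (condMutualInfo μ (fun ω => u (J ω)) Y S + Real.log 2) / Real.log M) 0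
      ≤ μ.real E := by
    refine max_le ?_ measureReal_nonneg
    rw [sub_le_comm, le_div_iff₀ hlogM, hmi]
    linarith
  have hEm : MeasurableSet E :=
    (measurableSet_eq_fun ((measurable_of_finite fun w : 𝒴 × 𝒮 => φ (dec w.1 w.2) w.2).comp
      (hY.prodMk hS)) hJ).compl
  have hint : Integrable (fun ω => ℓ (u (J ω)) (dec (Y ω) (S ω))) μ := by
    have hmeas : Measurable fun ω => ℓ (u (J ω)) (dec (Y ω) (S ω)) :=
      hℓmeas.comp (((measurable_of_finite u).comp hJ).prodMk (hdec.comp (hY.prodMk hS)))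
    refine Integrable.of_bound hmeas.aestronglyMeasurable 1 (.of_forall fun ω => ?_)
    rw [Real.norm_of_nonneg (hℓ01 _ _).1]
    exact (hℓ01 _ _).2
  exact (mul_le_mul_of_nonneg_left hmax (by linarith)).trans
    (mul_measureReal_le_integral hint (fun _ => (hℓ01 _ _).1) hEm fun _ => hlink _ _ _)
end

section
/- Let 𝒵 be a measurable space, ν a probability measure on 𝒵, Θ a measurable space, Q a probability measure on Θ, g : 𝒵 × Θ → [0,1] jointly measurable, R(θ) = E_{Z∼ν}[g(Z,θ)], R̂_m(D,θ) = (1/m)Σ_{i=1}^m g(Z_i,θ), and let P(·|D) be a Markov kernel from datasets D ∈ 𝒵^m to probability measures on Θ. Then for all δ, η ∈ (0,1), with probability at least 1 − δ − η over D drawn i.i.d. from ν^{⊗m}: E_{θ∼P(·|D)}[R(θ)] ≤ E_{θ∼P(·|D)}[R̂_m(D,θ)] + √( ( E_{D'}[KL(P(·|D')‖Q)]/η + log(1/δ) ) / (2m) ), where E_{D'} denotes expectation over an independent dataset with the same law. -/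
open MeasureTheory Real ENNReal Classical ProbabilityTheory

/-- Kullback–Leibler divergence `KL(P‖Q) = ∫ log(dP/dQ) dP` when `P ≪ Q` (and the
log-likelihood ratio is `P`-integrable), and `+∞` otherwise. -/
noncomputable def klDiv {Θ : Type*} [MeasurableSpace Θ] (P Q : Measure Θ) : ℝ≥0∞ :=
  if P ≪ Q ∧ Integrable (llr P Q) P then ENNReal.ofReal (∫ θ, llr P Q θ ∂P) else ⊤

/-- **Markov's inequality** for a possibly non-measurable function, in terms of the outer measure
of its sublevel set. -/
theorem one_sub_lintegral_div_le_measure_le {Ω : Type*} [MeasurableSpace Ω]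
    (μ : Measure Ω) [IsProbabilityMeasure μ] (f : Ω → ℝ≥0∞) {c : ℝ≥0∞} (hc : c ≠ 0)
    (hc' : c ≠ ⊤) : 1 - (∫⁻ x, f x ∂μ) / c ≤ μ {x | f x ≤ c} := by
  have hT : MeasurableSet (toMeasurable μ {x | f x ≤ c}) := measurableSet_toMeasurable _ _
  have h : μ (toMeasurable μ {x | f x ≤ c})ᶜ ≤ (∫⁻ x, f x ∂μ) / c := by
    rw [ENNReal.le_div_iff_mul_le (Or.inl hc) (Or.inl hc'), mul_comm,
      ← lintegral_indicator_const hT.compl]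
    refine lintegral_mono fun x => ?_
    by_cases hx : x ∈ toMeasurable μ {x | f x ≤ c}
    · simp [hx]
    · have : ¬ f x ≤ c := fun h => hx (subset_toMeasurable μ _ h)
      simpa [hx] using (not_le.1 this).le
  rw [tsub_le_iff_right, ← measure_toMeasurable {x | f x ≤ c},
    ← prob_add_prob_compl (μ := μ) hT]
  gcongr

/-- The **Donsker–Varadhan** change-of-measure inequality. -/
theorem integral_le_integral_llr_add_log_integral_exp {Θ : Type*} [MeasurableSpace Θ]
    (P Q : Measure Θ) [IsProbabilityMeasure P] [IsProbabilityMeasure Q] {f : Θ → ℝ}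
    (hPQ : P ≪ Q) (hllr : Integrable (llr P Q) P) (hf : Integrable f P)
    (hexp : Integrable (fun θ => Real.exp (f θ)) Q) :
    ∫ θ, f θ ∂P ≤ ∫ θ, llr P Q θ ∂P + Real.log (∫ θ, Real.exp (f θ) ∂Q) := by
  have := isProbabilityMeasure_tilted hexp
  have h := InformationTheory.integral_llr_add_sub_measure_univ_nonneg
    (hPQ.trans (absolutelyContinuous_tilted hexp))
    (integrable_llr_tilted_right hPQ hf hllr hexp)
  rw [integral_llr_tilted_right hPQ hf hexp hllr] at h
  simp only [probReal_univ] at h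
  linarith

/-- **Hoeffding's lemma** for the empirical mean of i.i.d. `[0, 1]`-valued random variables. -/
theorem lintegral_exp_mul_integral_sub_mean_le {𝒵 : Type*} [MeasurableSpace 𝒵]
    (ν : Measure 𝒵) [IsProbabilityMeasure ν] {f : 𝒵 → ℝ} (hf : Measurable f)
    (hf01 : ∀ z, f z ∈ Set.Icc (0 : ℝ) 1) {m : ℕ} (hm : 0 < m) (t : ℝ) :
    ∫⁻ D : Fin m → 𝒵, ENNReal.ofReal
        (Real.exp (t * ((∫ z, f z ∂ν) - (m : ℝ)⁻¹ * ∑ i, f (D i)))) ∂Measure.pi (fun _ => ν)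
      ≤ ENNReal.ofReal (Real.exp (t ^ 2 / (8 * m))) := by
  have hm' : (m : ℝ) ≠ 0 := by positivity
  have hsub := hasSubgaussianMGF_of_mem_Icc (μ := ν) hf.aemeasurable (ae_of_all _ hf01)
  have hfac : ∀ D : Fin m → 𝒵,
      Real.exp (t * ((∫ z, f z ∂ν) - (m : ℝ)⁻¹ * ∑ i, f (D i)))
        = ∏ i, Real.exp (-(t / m) * (f (D i) - ∫ z, f z ∂ν)) := by
    intro D
    rw [← Real.exp_sum, ← Finset.mul_sum, Finset.sum_sub_distrib]
    congr 1
    simp only [Finset.sum_const, Finset.card_univ, Fintype.card_fin, nsmul_eq_mul]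
    field_simp
    ring
  simp_rw [hfac]
  rw [← ofReal_integral_eq_lintegral_ofReal
    (Integrable.fintype_prod fun _ => hsub.integrable_exp_mul _)
    (ae_of_all _ fun D => Finset.prod_nonneg fun i _ => (Real.exp_pos _).le),
    integral_fintype_prod_eq_pow (fun z => Real.exp (-(t / m) * (f z - ∫ z, f z ∂ν)))]
  refine ENNReal.ofReal_le_ofReal ?_
  calc _ ≤ Real.exp (((‖(1 : ℝ) - 0‖₊ / 2) ^ 2 : NNReal) * (-(t / m)) ^ 2 / 2) ^ m := by
        rw [Fintype.card_fin]
        exact pow_le_pow_left₀ (integral_nonneg fun _ => (Real.exp_pos _).le)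
          (hsub.mgf_le (-(t / m))) m
    _ = _ := by
        rw [← Real.exp_nat_mul]
        congr 1
        simp
        field_simp
        ring

/-- **PAC–Bayes bound** on the event that the divergence of the posterior is at most `c`. -/
theorem measure_klDiv_le_le_measure_gap_le_add {𝒵 Θ : Type*} [MeasurableSpace 𝒵]
    [MeasurableSpace Θ] (ν : Measure 𝒵) [IsProbabilityMeasure ν]
    (Q : Measure Θ) [IsProbabilityMeasure Q]
    {g : 𝒵 × Θ → ℝ} (hg : Measurable g) (hg01 : ∀ p, g p ∈ Set.Icc (0 : ℝ) 1)
    {m : ℕ} (hm : 0 < m) (P : Kernel (Fin m → 𝒵) Θ) [IsMarkovKernel P]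
    {a c : ℝ} (ha : 0 < a) (hc : 0 ≤ c) :
    Measure.pi (fun _ : Fin m => ν) {D | klDiv (P D) Q ≤ ENNReal.ofReal c} ≤
      Measure.pi (fun _ : Fin m => ν)
        {D | ∫ θ, (∫ z, g (z, θ) ∂ν) ∂(P D) ≤
          ∫ θ, ((m : ℝ)⁻¹ * ∑ i : Fin m, g (D i, θ)) ∂(P D) + √(a / (2 * m))}
      + ENNReal.ofReal (Real.exp (c - a)) := by
  have hm' : (0 : ℝ) < m := by exact_mod_cast hm
  set μ := Measure.pi (fun _ : Fin m => ν)
  have hRm : Measurable fun θ => ∫ z, g (z, θ) ∂ν :=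
    hg.stronglyMeasurable.integral_prod_left'.measurable
  have hEm : Measurable fun p : (Fin m → 𝒵) × Θ => (m : ℝ)⁻¹ * ∑ i, g (p.1 i, p.2) := by
    fun_prop
  have hR : ∀ θ, ∫ z, g (z, θ) ∂ν ∈ Set.Icc (0 : ℝ) 1 := by
    intro θ
    refine ⟨integral_nonneg fun z => (hg01 _).1, ?_⟩
    calc _ ≤ ∫ _, (1 : ℝ) ∂ν := integral_mono_of_nonneg (ae_of_all _ fun z => (hg01 _).1)
          (integrable_const _) (ae_of_all _ fun z => (hg01 _).2)
      _ = 1 := by simp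
  have hE : ∀ (D : Fin m → 𝒵) (θ : Θ), (m : ℝ)⁻¹ * ∑ i : Fin m, g (D i, θ) ∈ Set.Icc (0 : ℝ) 1 := by
    intro D θ
    refine ⟨mul_nonneg (by positivity) (Finset.sum_nonneg fun i _ => (hg01 _).1), ?_⟩
    rw [inv_mul_le_iff₀ hm', mul_one]
    calc _ ≤ ∑ i : Fin m, (1 : ℝ) := Finset.sum_le_sum fun i _ => (hg01 _).2
      _ = m := by simp
  set t := √(8 * m * a)
  have ht : 0 < t := by positivity
  have ht2 : t ^ 2 = 8 * m * a := Real.sq_sqrt (by positivity)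
  have hta : t * √(a / (2 * m)) = 2 * a := by
    rw [← Real.sqrt_mul (by positivity), show 8 * m * a * (a / (2 * m)) = (2 * a) ^ 2 by
      field_simp; ring, Real.sqrt_sq (by positivity)]
  let h : (Fin m → 𝒵) → Θ → ℝ := fun D θ =>
    t * ((∫ z, g (z, θ) ∂ν) - (m : ℝ)⁻¹ * ∑ i, g (D i, θ))
  have hhm : Measurable (Function.uncurry h) := by
    exact ((hRm.comp measurable_snd).sub hEm).const_mul t
  have hhb : ∀ D θ, h D θ ∈ Set.Icc (-t) t := by
    intro D θ
    have h1 := hR θ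
    have h2 := hE D θ
    constructor <;> simp only [h] <;> nlinarith [h1.1, h1.2, h2.1, h2.2]
  have hhmD : ∀ D, Measurable (h D) := fun D => hhm.comp measurable_prodMk_left
  have hexp : ∀ D, Integrable (fun θ => Real.exp (h D θ)) Q := fun D =>
    Integrable.of_mem_Icc 0 (Real.exp t) (Real.measurable_exp.comp (hhmD D)).aemeasurable
      (ae_of_all _ fun θ => ⟨(Real.exp_pos _).le, Real.exp_le_exp.2 (hhb D θ).2⟩)
  have hFm : Measurable fun p : (Fin m → 𝒵) × Θ =>
      ENNReal.ofReal (Real.exp (h p.1 p.2)) :=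
    (Real.measurable_exp.comp hhm).ennreal_ofReal
  have hF : ∫⁻ D, ∫⁻ θ, ENNReal.ofReal (Real.exp (h D θ)) ∂Q ∂μ ≤ ENNReal.ofReal (Real.exp a) := by
    rw [lintegral_lintegral_swap hFm.aemeasurable]
    calc _ ≤ ∫⁻ _, ENNReal.ofReal (Real.exp a) ∂Q := by
          refine lintegral_mono fun θ => ?_
          refine (lintegral_exp_mul_integral_sub_mean_le ν (hg.comp measurable_prodMk_right)
            (fun z => hg01 (z, θ)) hm t).trans_eq ?_
          rw [ht2]
          congr 2
          field_simp
      _ = _ := by simp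
  have hbad : μ {D | ENNReal.ofReal (Real.exp (2 * a - c)) ≤
      ∫⁻ θ, ENNReal.ofReal (Real.exp (h D θ)) ∂Q} ≤ ENNReal.ofReal (Real.exp (c - a)) := by
    refine (meas_ge_le_lintegral_div hFm.lintegral_prod_right'.aemeasurable
      (by simpa using Real.exp_pos _) ENNReal.ofReal_ne_top).trans ?_
    refine (ENNReal.div_le_div_right hF _).trans_eq ?_
    rw [← ENNReal.ofReal_div_of_pos (Real.exp_pos _), ← Real.exp_sub]
    congr 2
    ring
  refine le_trans (measure_mono fun D hD => ?_) ((measure_union_le _ _).trans (by gcongr))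
  rw [Set.mem_union, or_iff_not_imp_right]
  intro hD'
  simp only [Set.mem_ofPred_eq, not_le] at hD hD' ⊢
  rw [← ofReal_integral_eq_lintegral_ofReal (hexp D)
    (ae_of_all _ fun θ => (Real.exp_pos _).le),
    ENNReal.ofReal_lt_ofReal_iff (Real.exp_pos _)] at hD'
  have hlog : Real.log (∫ θ, Real.exp (h D θ) ∂Q) ≤ 2 * a - c :=
    (Real.log_le_iff_le_exp (integral_exp_pos (hexp D))).2 hD'.le
  unfold klDiv at hD
  split_ifs at hD with hPQ
  · rw [ENNReal.ofReal_le_ofReal_iff hc] at hD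
    have hint : Integrable (h D) (P D) :=
      Integrable.of_mem_Icc _ _ (hhmD D).aemeasurable (ae_of_all _ (hhb D))
    have hdv := integral_le_integral_llr_add_log_integral_exp (P D) Q hPQ.1 hPQ.2 hint (hexp D)
    have hsplit : ∫ θ, h D θ ∂(P D) = t * (∫ θ, (∫ z, g (z, θ) ∂ν) ∂(P D) -
        ∫ θ, ((m : ℝ)⁻¹ * ∑ i : Fin m, g (D i, θ)) ∂(P D)) := by
      have hEint : Integrable (fun θ => (m : ℝ)⁻¹ * ∑ i, g (D i, θ)) (P D) :=
        Integrable.of_mem_Icc 0 1 (hEm.comp measurable_prodMk_left).aemeasurable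
          (ae_of_all _ (hE D))
      rw [← integral_sub (Integrable.of_mem_Icc 0 1 hRm.aemeasurable (ae_of_all _ hR)) hEint,
        ← integral_const_mul]
    refine sub_le_iff_le_add'.1 (le_of_mul_le_mul_left ?_ ht)
    rw [hta]
    linarith
  · exact absurd hD (by simp)

/-- Corollary F.2 (Capacity-Aware High-Probability Upper Bound): for a bounded loss
`g : 𝒵 × Θ → [0,1]` and a posterior kernel `P(·|D)`, for all `δ, η ∈ (0,1)`, with
probability at least `1 − δ − η` over `D ∼ ν^{⊗m}`:
`E_{θ∼P(·|D)}[R(θ)] ≤ E_{θ∼P(·|D)}[R̂_m(D,θ)] + √((E_{D'}[KL(P(·|D')‖Q)]/η + log(1/δ))/(2m))`. -/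
theorem capacity_aware_high_probability_bound
    {𝒵 Θ : Type*} [MeasurableSpace 𝒵] [MeasurableSpace Θ]
    (ν : Measure 𝒵) [IsProbabilityMeasure ν]
    (Q : Measure Θ) [IsProbabilityMeasure Q]
    (g : 𝒵 × Θ → ℝ) (hg : Measurable g) (hg01 : ∀ p, g p ∈ Set.Icc (0 : ℝ) 1)
    (m : ℕ) (hm : 0 < m)
    (P : Kernel (Fin m → 𝒵) Θ) [IsMarkovKernel P]
    (δ η : ℝ) (hδ : δ ∈ Set.Ioo (0 : ℝ) 1) (hη : η ∈ Set.Ioo (0 : ℝ) 1) :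
    1 - ENNReal.ofReal δ - ENNReal.ofReal η ≤
      Measure.pi (fun _ : Fin m => ν)
        {D : Fin m → 𝒵 |
          ENNReal.ofReal (∫ θ, (∫ z, g (z, θ) ∂ν) ∂(P D)) ≤
            ENNReal.ofReal (∫ θ, ((m : ℝ)⁻¹ * ∑ i : Fin m, g (D i, θ)) ∂(P D))
              + ((((∫⁻ D', klDiv (P D') Q ∂(Measure.pi (fun _ : Fin m => ν)))
                    / ENNReal.ofReal η)
                  + ENNReal.ofReal (Real.log (1 / δ))) / (2 * m)) ^ (1/2 : ℝ)} := by
  obtain ⟨hδ0, hδ1⟩ := hδ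
  obtain ⟨hη0, hη1⟩ := hη
  have hm' : (0 : ℝ) < m := by exact_mod_cast hm
  set μ := Measure.pi (fun _ : Fin m => ν)
  set L := ∫⁻ D', klDiv (P D') Q ∂μ
  have hlog : 0 < Real.log (1 / δ) := Real.log_pos (by rw [lt_div_iff₀ hδ0]; linarith)
  have hηne : ENNReal.ofReal η ≠ 0 := by simpa using hη0
  have hgap : ∀ a : ℝ, 0 < a →
      ENNReal.ofReal a ≤ L / ENNReal.ofReal η + ENNReal.ofReal (Real.log (1 / δ)) →
      {D : Fin m → 𝒵 | ∫ θ, (∫ z, g (z, θ) ∂ν) ∂(P D) ≤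
          ∫ θ, ((m : ℝ)⁻¹ * ∑ i : Fin m, g (D i, θ)) ∂(P D) + √(a / (2 * m))} ⊆
        {D : Fin m → 𝒵 | ENNReal.ofReal (∫ θ, (∫ z, g (z, θ) ∂ν) ∂(P D)) ≤
          ENNReal.ofReal (∫ θ, ((m : ℝ)⁻¹ * ∑ i : Fin m, g (D i, θ)) ∂(P D))
            + ((L / ENNReal.ofReal η + ENNReal.ofReal (Real.log (1 / δ))) / (2 * m))
              ^ (1/2 : ℝ)} := by
    intro a ha hle D hD
    refine (ENNReal.ofReal_le_ofReal hD).trans (ENNReal.ofReal_add_le.trans ?_)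
    gcongr
    rw [Real.sqrt_eq_rpow, ← ENNReal.ofReal_rpow_of_nonneg (by positivity) (by norm_num),
      ENNReal.ofReal_div_of_pos (by positivity), ENNReal.ofReal_mul (by norm_num),
      ENNReal.ofReal_natCast, ENNReal.ofReal_ofNat]
    gcongr
  rcases eq_or_ne L ⊤ with hL | hL
  · refine tsub_le_self.trans (tsub_le_self.trans ?_)
    rw [← measure_univ (μ := μ)]
    refine measure_mono fun D _ => ?_
    have htop : ((L / ENNReal.ofReal η + ENNReal.ofReal (Real.log (1 / δ))) / (2 * m))
        ^ (1/2 : ℝ) = ⊤ := by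
      rw [hL, ENNReal.top_div_of_ne_top ENNReal.ofReal_ne_top, top_add,
        ENNReal.top_div_of_ne_top (by finiteness), ENNReal.top_rpow_of_pos (by norm_num)]
    rw [Set.mem_ofPred_eq, htop, add_top]
    exact le_top
  rcases eq_or_ne L 0 with hL0 | hL0
  · -- A vanishing expected divergence leaves the failure probability `η` to be added to `δ`.
    have hc : 0 < Real.log ((δ + η) / δ) := Real.log_pos (by rw [lt_div_iff₀ hδ0]; linarith)
    have h1 := one_sub_lintegral_div_le_measure_le μ (fun D => klDiv (P D) Q)
      (c := ENNReal.ofReal (Real.log ((δ + η) / δ))) (by simpa using hc) ENNReal.ofReal_ne_top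
    have h2 := measure_klDiv_le_le_measure_gap_le_add ν Q hg hg01 hm P hlog hc.le
    have he : Real.exp (Real.log ((δ + η) / δ) - Real.log (1 / δ)) = δ + η := by
      rw [Real.exp_sub, Real.exp_log (by positivity), Real.exp_log (by positivity)]
      field_simp
    rw [he, ENNReal.ofReal_add hδ0.le hη0.le] at h2
    rw [show ∫⁻ D, klDiv (P D) Q ∂μ = 0 from hL0, ENNReal.zero_div, tsub_zero] at h1
    rw [tsub_tsub, tsub_le_iff_right]
    refine h1.trans (h2.trans ?_)
    exact add_le_add_left (measure_mono (hgap _ hlog le_add_self)) _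
  · have hc' : L / ENNReal.ofReal η ≠ ⊤ := ENNReal.div_ne_top hL hηne
    have hc0 : L / ENNReal.ofReal η ≠ 0 := by simp [hL0]
    have h1 := one_sub_lintegral_div_le_measure_le μ (fun D => klDiv (P D) Q) hc0 hc'
    have hdiv : L / (L / ENNReal.ofReal η) = ENNReal.ofReal η := by
      rw [ENNReal.div_div_cancel hL0 hL]
    set c := (L / ENNReal.ofReal η).toReal
    have hcc : ENNReal.ofReal c = L / ENNReal.ofReal η := ENNReal.ofReal_toReal hc'
    have hc : 0 ≤ c := ENNReal.toReal_nonneg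
    have ha : 0 < c + Real.log (1 / δ) := by positivity
    have h2 := measure_klDiv_le_le_measure_gap_le_add ν Q hg hg01 hm P ha hc
    have he : Real.exp (c - (c + Real.log (1 / δ))) = δ := by
      rw [sub_add_cancel_left, Real.exp_neg, Real.exp_log (by positivity)]
      simp
    rw [he, hcc] at h2
    rw [show ∫⁻ D, klDiv (P D) Q ∂μ = L from rfl, hdiv] at h1
    rw [tsub_right_comm, tsub_le_iff_right]
    refine h1.trans (h2.trans ?_)
    exact add_le_add_left
      (measure_mono (hgap _ ha (by rw [ENNReal.ofReal_add hc hlog.le, hcc]))) _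
end

section
/- Let (Ω, 𝔉, P) be a probability space, X : Ω → [0,1] a random variable, 𝒢 ⊆ 𝔉 a σ-algebra, c ≥ 0, ζ ∈ [0,1), E ∈ 𝒢 an event, and G = { E[X|𝒢] ≥ c } ∈ 𝒢. If P(Gᶜ | E) ≤ ζ (when P(E) > 0), then E[X] ≥ c·(1 − ζ)·P(E), and consequently E[X] ≥ c·P(E) − c·ζ ≥ c·P(E) − ζ when c ≤ 1. -/
open MeasureTheory Real

/-- The key inequality of Appendix L (Soft Loss–Index Link): if `X ∈ [0,1]`,
`E ∈ 𝒢`, `G = {E[X|𝒢] ≥ c}`, and `P(Gᶜ|E) ≤ ζ` whenever `P(E) > 0`, then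
`E[X] ≥ c·(1−ζ)·P(E)`, hence `E[X] ≥ c·P(E) − c·ζ`, and `E[X] ≥ c·P(E) − ζ` when `c ≤ 1`. -/
theorem soft_loss_index_link
    {Ω : Type*} {F : MeasurableSpace Ω} (μ : Measure Ω) [IsProbabilityMeasure μ]
    (X : Ω → ℝ) (hX : Measurable X) (hX01 : ∀ ω, X ω ∈ Set.Icc (0 : ℝ) 1)
    (G : MeasurableSpace Ω) (hG : G ≤ F)
    (c ζ : ℝ) (hc : 0 ≤ c) (hζ : ζ ∈ Set.Ico (0 : ℝ) 1)
    (E : Set Ω) (hE : MeasurableSet[G] E)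
    (hcond : 0 < (μ E).toReal →
      (μ ({ω | ¬ c ≤ (μ[X|G]) ω} ∩ E)).toReal ≤ ζ * (μ E).toReal) :
    c * (1 - ζ) * (μ E).toReal ≤ ∫ ω, X ω ∂μ ∧
    c * (μ E).toReal - c * ζ ≤ ∫ ω, X ω ∂μ ∧
    (c ≤ 1 → c * (μ E).toReal - ζ ≤ ∫ ω, X ω ∂μ) := by
  have hmarkov : c * μ.real {ω | c ≤ (μ[X|G]) ω} ≤ ∫ ω, X ω ∂μ := by
    rw [← integral_condExp hG (f := X)]
    exact mul_meas_ge_le_integral_of_nonneg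
      (condExp_nonneg (.of_forall fun ω => (hX01 ω).1)) integrable_condExp c
  have hbad : μ.real ({ω | ¬ c ≤ (μ[X|G]) ω} ∩ E) ≤ ζ * μ.real E := by
    rcases (measureReal_nonneg (μ := μ) (s := E)).eq_or_lt with h | h
    · rw [← h, mul_zero, h]
      exact measureReal_mono Set.inter_subset_right
    · exact hcond h
  have hsplit : μ.real E ≤
      μ.real {ω | c ≤ (μ[X|G]) ω} + μ.real ({ω | ¬ c ≤ (μ[X|G]) ω} ∩ E) := by
    refine (measureReal_mono fun ω hω => ?_).trans (measureReal_union_le _ _)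
    by_cases h : c ≤ (μ[X|G]) ω
    · exact Or.inl h
    · exact Or.inr ⟨h, hω⟩
  have hmain : c * (1 - ζ) * μ.real E ≤ ∫ ω, X ω ∂μ := by
    rw [mul_assoc]
    exact (mul_le_mul_of_nonneg_left (by linarith) hc).trans hmarkov
  have hadd : c * μ.real E - c * ζ ≤ ∫ ω, X ω ∂μ := by
    have h := mul_le_mul_of_nonneg_left (measureReal_le_one (μ := μ) (s := E))
      (mul_nonneg hc hζ.1)
    linarith
  refine ⟨hmain, hadd, fun hc1 => ?_⟩
  exact (sub_le_sub_left (mul_le_of_le_one_left hζ.1 hc1) _).trans hadd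
end

section
/- Let J, S, Y be random variables taking values in finite sets, with J uniformly distributed on {1,…,M}, M ≥ 2, and J independent of S; set U = u^{(J)} for fixed codebook points u^{(1)},…,u^{(M)}, and suppose Y is conditionally independent of J given (U,S). Let ℓ : 𝒰 × 𝒜 → [0,1] be measurable, φ : 𝒜 × 𝒮 → {1,…,M} measurable, π : 𝒴 × 𝒮 → 𝒜 a decoder, Ĵ = φ(π(Y,S),S), and suppose the soft loss–index link holds: P( ℓ(u^{(J)}, π(Y,S)) < ε + Δ | Ĵ ≠ J ) ≤ ζ for constants ε ≥ 0, Δ > 0 with ε + Δ ≤ 1 and ζ ∈ [0,1). Then E[ℓ(U, π(Y,S))] ≥ (ε + Δ)·(1 − ζ)·max{ 1 − (I(U;Y|S) + log 2)/log M , 0 }. -/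
open MeasureTheory Real

/-- The entropy of a function of a finite-valued random variable `W`, as an expectation over `W`. -/
lemma entropy_comp {Ω α δ : Type*} [MeasurableSpace Ω] [Fintype α] [Fintype δ]
    [MeasurableSpace δ] [MeasurableSingletonClass δ] (μ : Measure Ω) [IsFiniteMeasure μ]
    {W : Ω → δ} (hW : Measurable W) (f : δ → α) :
    entropy μ (fun ω => f (W ω))
      = ∑ w, μ.real (W ⁻¹' {w}) * -Real.log (μ.real {ω | f (W ω) = f w}) := by
  classical
  rw [← Finset.sum_fiberwise (g := f)]
  refine Finset.sum_congr rfl fun a _ => ?_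
  have hsum : ∑ w with f w = a, μ.real (W ⁻¹' {w}) = μ.real {ω | f (W ω) = a} := by
    rw [sum_measureReal_preimage_singleton _ fun w _ => hW (measurableSet_singleton w)]
    congr 1
    ext ω
    simp
  calc Real.negMulLog (μ.real {ω | f (W ω) = a})
      = ∑ w with f w = a, μ.real (W ⁻¹' {w}) * -Real.log (μ.real {ω | f (W ω) = a}) := by
        rw [← Finset.sum_mul, hsum, Real.negMulLog]
        ring
    _ = _ := Finset.sum_congr rfl fun w hw => by rw [(Finset.mem_filter.1 hw).2]

/-- The pointwise form of Gibbs' inequality. -/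
lemma mul_log_sub_log_le {p q : ℝ} (hp : 0 ≤ p) (hq : 0 ≤ q) (hpq : 0 < p → 0 < q) :
    p * (Real.log q - Real.log p) ≤ q - p := by
  rcases hp.eq_or_lt with rfl | hp
  · simpa using hq
  · rw [← Real.log_div (hpq hp).ne' hp.ne']
    calc p * Real.log (q / p) ≤ p * (q / p - 1) :=
          mul_le_mul_of_nonneg_left (Real.log_le_sub_one_of_pos (div_pos (hpq hp) hp)) hp.le
      _ = q - p := by field_simp

/-- The guess `j₀` gets weight `1/2` and every other index `1/(2M)`: the total is at most one. -/
lemma sum_guess_weight_le_one {M : ℕ} (j₀ : Fin M) :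
    ∑ j : Fin M, (if j = j₀ then (1 / 2 : ℝ) else 1 / (2 * M)) ≤ 1 := by
  have hM : (0 : ℝ) < M := Nat.cast_pos.2 j₀.pos
  calc ∑ j : Fin M, (if j = j₀ then (1 / 2 : ℝ) else 1 / (2 * M))
      ≤ ∑ j : Fin M, ((if j = j₀ then (1 / 2 : ℝ) else 0) + 1 / (2 * M)) := by
        gcongr with j
        split_ifs
        · have : (0 : ℝ) ≤ 1 / (2 * M) := by positivity
          linarith
        · simp
    _ = 1 := by
        rw [Finset.sum_add_distrib]
        simp
        field_simp
        norm_num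

/-- Fano's inequality with side information: guessing a uniform index `J` from `(Y, S)`, where `J`
is independent of `S` and `J → (u J, S) → Y` is a Markov chain. -/
lemma fano_condMutualInfo {Ω 𝒰 𝒴 𝒮 : Type*} [MeasurableSpace Ω] [Fintype 𝒰]
    [Fintype 𝒴] [MeasurableSpace 𝒴] [MeasurableSingletonClass 𝒴]
    [Fintype 𝒮] [MeasurableSpace 𝒮] [MeasurableSingletonClass 𝒮]
    (μ : Measure Ω) [IsProbabilityMeasure μ] {M : ℕ} (hM : M ≠ 0)
    {J : Ω → Fin M} {Y : Ω → 𝒴} {S : Ω → 𝒮}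
    (hJ : Measurable J) (hY : Measurable Y) (hS : Measurable S)
    (hunif : ∀ j : Fin M, μ (J ⁻¹' {j}) = 1 / M)
    (hindep : ∀ (j : Fin M) (s : 𝒮),
      μ {ω | J ω = j ∧ S ω = s} = μ (J ⁻¹' {j}) * μ (S ⁻¹' {s}))
    (u : Fin M → 𝒰)
    (hcondindep : ∀ (j : Fin M) (y : 𝒴) (v : 𝒰) (s : 𝒮),
      μ {ω | J ω = j ∧ Y ω = y ∧ u (J ω) = v ∧ S ω = s} * μ {ω | u (J ω) = v ∧ S ω = s}
        = μ {ω | J ω = j ∧ u (J ω) = v ∧ S ω = s}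
          * μ {ω | Y ω = y ∧ u (J ω) = v ∧ S ω = s})
    (g : 𝒴 → 𝒮 → Fin M) :
    (1 - μ.real {ω | g (Y ω) (S ω) ≠ J ω}) * Real.log M
      ≤ condMutualInfo μ (fun ω => u (J ω)) Y S + Real.log 2 := by
  have hM' : (0 : ℝ) < M := by positivity
  set W : Ω → Fin M × 𝒴 × 𝒮 := fun ω => (J ω, Y ω, S ω) with hWdef
  have hW : Measurable W := hJ.prodMk (hY.prodMk hS)
  have hWs : ∀ w, MeasurableSet (W ⁻¹' {w}) := fun w => hW (measurableSet_singleton w)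
  set p : Fin M × 𝒴 × 𝒮 → ℝ := fun w => μ.real (W ⁻¹' {w}) with hp
  have hp_sum : ∑ w, p w = 1 := by
    rw [hp, sum_measureReal_preimage_singleton _ fun w _ => hWs w]
    simp
  set r : Fin M × 𝒴 × 𝒮 → ℝ := fun w => if w.1 = g w.2.1 w.2.2 then 1 / 2 else 1 / (2 * M) with hr
  have hr_pos : ∀ w, 0 < r w := fun w => by
    simp only [hr]
    split_ifs <;> positivity
  set P : 𝒴 × 𝒮 → ℝ := fun z => μ.real {ω | (Y ω, S ω) = z} with hP
  have hP_sum : ∑ z, P z = 1 := by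
    refine (sum_measureReal_preimage_singleton (f := fun ω => (Y ω, S ω)) Finset.univ
      fun z _ => (hY.prodMk hS) (measurableSet_singleton z)).trans ?_
    simp
  have hq_sum : ∑ w, P w.2 * r w ≤ 1 := by
    rw [Fintype.sum_prod_type, Finset.sum_comm, ← hP_sum]
    refine Finset.sum_le_sum fun z _ => ?_
    simp only [← Finset.mul_sum]
    exact mul_le_of_le_one_right measureReal_nonneg (sum_guess_weight_le_one (g z.1 z.2))
  have herr : μ.real {ω | g (Y ω) (S ω) ≠ J ω}
      = ∑ w, p w * (if w.1 = g w.2.1 w.2.2 then 0 else 1) := by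
    have : ∑ w with ¬ w.1 = g w.2.1 w.2.2, p w = μ.real {ω | g (Y ω) (S ω) ≠ J ω} := by
      rw [hp, sum_measureReal_preimage_singleton _ fun w _ => hWs w]
      congr 1
      ext ω
      simp [hWdef, eq_comm]
    rw [← this, Finset.sum_filter]
    exact Finset.sum_congr rfl fun w _ => by split_ifs <;> simp
  have hI : condMutualInfo μ (fun ω => u (J ω)) Y S
      = ∑ w, p w * (Real.log M + Real.log (p w) - Real.log (P w.2)) := by
    have h1 := entropy_comp μ hW fun w => (u w.1, w.2.2)
    have h2 := entropy_comp μ hW fun w => w.2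
    have h3 := entropy_comp μ hW fun w => (u w.1, w.2)
    have h4 := entropy_comp μ hW fun w => w.2.2
    rw [condMutualInfo, h1, h2, h3, h4, ← Finset.sum_add_distrib, ← Finset.sum_sub_distrib,
      ← Finset.sum_sub_distrib]
    refine Finset.sum_congr rfl fun ⟨j, y, s⟩ _ => ?_
    simp only [← mul_add, ← mul_sub]
    rcases (measureReal_nonneg (μ := μ) (s := W ⁻¹' {(j, y, s)})).eq_or_lt with h0 | hpos
    · simp [hp, ← h0]
    · congr 1
      have hle : ∀ A : Set Ω, W ⁻¹' {(j, y, s)} ⊆ A → 0 < μ.real A := fun A hA =>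
        hpos.trans_le (measureReal_mono hA)
      have hus : 0 < μ.real {ω | (u (J ω), S ω) = (u j, s)} := hle _ fun ω hω => by
        simp_all
      have huys : 0 < μ.real {ω | (u (J ω), Y ω, S ω) = (u j, y, s)} := hle _ fun ω hω => by
        simp_all
      have hs : 0 < μ.real {ω | S ω = s} := hle _ fun ω hω => by simp_all
      have hmarkov : μ.real (W ⁻¹' {(j, y, s)}) * μ.real {ω | (u (J ω), S ω) = (u j, s)} * M
          = μ.real {ω | S ω = s} * μ.real {ω | (u (J ω), Y ω, S ω) = (u j, y, s)} := by
        have hc := congrArg ENNReal.toReal (hcondindep j y (u j) s)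
        have hi := congrArg ENNReal.toReal (hindep j s)
        rw [hunif] at hi
        have e1 : {ω | J ω = j ∧ Y ω = y ∧ u (J ω) = u j ∧ S ω = s} = W ⁻¹' {(j, y, s)} := by
          ext ω
          simp only [hWdef, Set.mem_ofPred_eq, Set.mem_preimage, Set.mem_singleton_iff,
            Prod.mk.injEq]
          grind
        have e2 : {ω | J ω = j ∧ u (J ω) = u j ∧ S ω = s} = {ω | J ω = j ∧ S ω = s} := by
          ext ω
          simp only [Set.mem_ofPred_eq]
          grind
        have e3 : {ω | Y ω = y ∧ u (J ω) = u j ∧ S ω = s}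
            = {ω | (u (J ω), Y ω, S ω) = (u j, y, s)} := by
          ext ω
          simp only [Set.mem_ofPred_eq, Prod.mk.injEq]
          grind
        have e4 : {ω | u (J ω) = u j ∧ S ω = s} = {ω | (u (J ω), S ω) = (u j, s)} := by
          simp only [Prod.mk.injEq]
        rw [e1, e2, e3, e4, ENNReal.toReal_mul, ENNReal.toReal_mul, hi, ENNReal.toReal_mul] at hc
        simp only [measureReal_def, hc]
        simp only [one_div, ENNReal.toReal_inv, ENNReal.toReal_natCast]
        field_simp
        exact mul_comm _ _
      have hlog := congrArg Real.log hmarkov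
      rw [Real.log_mul (by positivity) hM'.ne', Real.log_mul hpos.ne' hus.ne',
        Real.log_mul hs.ne' huys.ne'] at hlog
      simp only [hp, hP]
      simp only [hWdef] at hlog ⊢
      linarith
  have hgibbs : ∑ w, p w * (Real.log (P w.2) + Real.log (r w) - Real.log (p w)) ≤ 0 := by
    calc ∑ w, p w * (Real.log (P w.2) + Real.log (r w) - Real.log (p w))
        ≤ ∑ w, (P w.2 * r w - p w) := by
          refine Finset.sum_le_sum fun w _ => ?_
          have hPpos : 0 < p w → 0 < P w.2 := fun h => h.trans_le <|
            measureReal_mono fun ω hω => by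
              simp only [hWdef, Set.mem_preimage, Set.mem_singleton_iff] at hω
              simp [← hω]
          rcases (show 0 ≤ p w from measureReal_nonneg).eq_or_lt with h0 | hpos
          · rw [← h0]
            simpa using mul_nonneg measureReal_nonneg (hr_pos w).le
          · rw [← Real.log_mul (hPpos hpos).ne' (hr_pos w).ne']
            exact mul_log_sub_log_le hpos.le
              (mul_nonneg measureReal_nonneg (hr_pos w).le)
              fun h => mul_pos (hPpos h) (hr_pos w)
      _ ≤ 0 := by
          rw [Finset.sum_sub_distrib, hp_sum]
          linarith
  have hlogr : ∀ w, Real.log (r w)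
      = -Real.log 2 - (if w.1 = g w.2.1 w.2.2 then 0 else 1) * Real.log M := fun w => by
    simp only [hr]
    split_ifs
    · simp
    · rw [one_div, Real.log_inv, Real.log_mul two_ne_zero hM'.ne']
      ring
  have hcomb : Real.log M - Real.log 2 - μ.real {ω | g (Y ω) (S ω) ≠ J ω} * Real.log M
      = ∑ w, p w * (Real.log M + Real.log (p w) - Real.log (P w.2))
        + ∑ w, p w * (Real.log (P w.2) + Real.log (r w) - Real.log (p w)) := by
    rw [← Finset.sum_add_distrib, herr]
    calc _ = (∑ w, p w) * (Real.log M - Real.log 2)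
          - (∑ w, p w * (if w.1 = g w.2.1 w.2.2 then 0 else 1)) * Real.log M := by
          rw [hp_sum, one_mul]
      _ = _ := by
          rw [Finset.sum_mul, Finset.sum_mul, ← Finset.sum_sub_distrib]
          refine Finset.sum_congr rfl fun w _ => ?_
          rw [hlogr]
          ring
  rw [hI]
  linarith

/-- Markov's inequality restricted to an event `E` on which `f` is rarely below `c`. -/
lemma mul_measureReal_le_integral_of_rarely_lt {Ω : Type*} [MeasurableSpace Ω] {μ : Measure Ω}
    [IsFiniteMeasure μ] {f : Ω → ℝ} (hf : Integrable f μ) (hf0 : 0 ≤ f) {E : Set Ω} {c ζ : ℝ}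
    (hc : 0 ≤ c) (hE : μ.real {ω | f ω < c ∧ ω ∈ E} ≤ ζ * μ.real E) :
    c * (1 - ζ) * μ.real E ≤ ∫ ω, f ω ∂μ := by
  have hcover : μ.real E ≤ μ.real {ω | c ≤ f ω} + μ.real {ω | f ω < c ∧ ω ∈ E} :=
    (measureReal_mono fun ω hω => (le_or_gt c (f ω)).imp id fun h => ⟨h, hω⟩).trans
      (measureReal_union_le _ _)
  calc c * (1 - ζ) * μ.real E = c * (μ.real E - ζ * μ.real E) := by ring
    _ ≤ c * μ.real {ω | c ≤ f ω} := mul_le_mul_of_nonneg_left (by linarith) hc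
    _ ≤ ∫ ω, f ω ∂μ := mul_meas_ge_le_integral_of_nonneg (.of_forall hf0) hf c

/-- Multiplicative-slack Fano–Packing Lower Bound (end of Appendix L): under the soft
loss–index link `P(ℓ(u^{(J)},π(Y,S)) < ε+Δ | Ĵ ≠ J) ≤ ζ`,
`E[ℓ(U, π(Y,S))] ≥ (ε+Δ)·(1−ζ)·max{1 − (I(U;Y|S)+log 2)/log M, 0}`. -/
theorem soft_fano_packing_lower_bound
    {Ω 𝒰 𝒜 𝒴 𝒮 : Type*} [MeasurableSpace Ω]
    [Fintype 𝒰] [MeasurableSpace 𝒰] [MeasurableSingletonClass 𝒰]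
    [MeasurableSpace 𝒜]
    [Fintype 𝒴] [MeasurableSpace 𝒴] [MeasurableSingletonClass 𝒴]
    [Fintype 𝒮] [MeasurableSpace 𝒮] [MeasurableSingletonClass 𝒮]
    (μ : Measure Ω) [IsProbabilityMeasure μ]
    (M : ℕ) (hM : 2 ≤ M)
    (J : Ω → Fin M) (Y : Ω → 𝒴) (S : Ω → 𝒮)
    (hJ : Measurable J) (hY : Measurable Y) (hS : Measurable S)
    (hunif : ∀ j : Fin M, μ (J ⁻¹' {j}) = 1 / M)
    (hindep : ∀ (j : Fin M) (s : 𝒮),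
      μ {ω | J ω = j ∧ S ω = s} = μ (J ⁻¹' {j}) * μ (S ⁻¹' {s}))
    (u : Fin M → 𝒰)
    (hcondindep : ∀ (j : Fin M) (y : 𝒴) (v : 𝒰) (s : 𝒮),
      μ {ω | J ω = j ∧ Y ω = y ∧ u (J ω) = v ∧ S ω = s} * μ {ω | u (J ω) = v ∧ S ω = s}
        = μ {ω | J ω = j ∧ u (J ω) = v ∧ S ω = s}
          * μ {ω | Y ω = y ∧ u (J ω) = v ∧ S ω = s})
    (ℓ : 𝒰 → 𝒜 → ℝ) (hℓmeas : Measurable (Function.uncurry ℓ))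
    (hℓ01 : ∀ x b, ℓ x b ∈ Set.Icc (0 : ℝ) 1)
    (φ : 𝒜 → 𝒮 → Fin M) (hφ : Measurable (Function.uncurry φ))
    (dec : 𝒴 → 𝒮 → 𝒜) (hdec : Measurable (Function.uncurry dec))
    (ε Δ : ℝ) (hε : 0 ≤ ε) (hΔ : 0 < Δ) (hεΔ : ε + Δ ≤ 1)
    (ζ : ℝ) (hζ : ζ ∈ Set.Ico (0 : ℝ) 1)
    (hsoft : 0 < (μ {ω | φ (dec (Y ω) (S ω)) (S ω) ≠ J ω}).toReal →
      (μ {ω | ℓ (u (J ω)) (dec (Y ω) (S ω)) < ε + Δ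
            ∧ φ (dec (Y ω) (S ω)) (S ω) ≠ J ω}).toReal
        ≤ ζ * (μ {ω | φ (dec (Y ω) (S ω)) (S ω) ≠ J ω}).toReal) :
    (ε + Δ) * (1 - ζ)
        * max (1 - (condMutualInfo μ (fun ω => u (J ω)) Y S + Real.log 2) / Real.log M) 0
      ≤ ∫ ω, ℓ (u (J ω)) (dec (Y ω) (S ω)) ∂μ := by
  have hlogM : 0 < Real.log M := Real.log_pos (by exact_mod_cast hM)
  have hfano := fano_condMutualInfo μ (by omega) hJ hY hS hunif hindep u hcondindep
    fun y s => φ (dec y s) s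
  have hf : Integrable (fun ω => ℓ (u (J ω)) (dec (Y ω) (S ω))) μ := by
    have hmeas : Measurable fun ω => ℓ (u (J ω)) (dec (Y ω) (S ω)) :=
      hℓmeas.comp (((measurable_of_finite u).comp hJ).prodMk (hdec.comp (hY.prodMk hS)))
    refine .of_bound hmeas.aestronglyMeasurable 1 (.of_forall fun ω => ?_)
    rw [Real.norm_of_nonneg (hℓ01 _ _).1]
    exact (hℓ01 _ _).2
  have hsoft' : μ.real {ω | ℓ (u (J ω)) (dec (Y ω) (S ω)) < ε + Δ
      ∧ ω ∈ {ω | φ (dec (Y ω) (S ω)) (S ω) ≠ J ω}}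
        ≤ ζ * μ.real {ω | φ (dec (Y ω) (S ω)) (S ω) ≠ J ω} := by
    rcases (measureReal_nonneg
      (μ := μ) (s := {ω | φ (dec (Y ω) (S ω)) (S ω) ≠ J ω})).eq_or_lt with h0 | hpos
    · rw [← h0, mul_zero, h0]
      exact measureReal_mono fun ω hω => hω.2
    · exact hsoft hpos
  refine le_trans ?_ (mul_measureReal_le_integral_of_rarely_lt hf (fun ω => (hℓ01 _ _).1)
    (by positivity) hsoft')
  refine mul_le_mul_of_nonneg_left (max_le ?_ measureReal_nonneg)
    (mul_nonneg (by positivity) (sub_nonneg.2 hζ.2.le))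
  rw [sub_le_comm, le_div_iff₀ hlogM]
  exact hfano
end
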